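/- Quantitative implicit function theorem: Let X, Y, and Z be Banach spaces, U ⊆ X × Y an open set, and f : X × Y → Z continuously Fréchet differentiable on U. Let (x₀, y₀) ∈ U with f(x₀, y₀) = 0. Suppose the partial Fréchet derivative δ_y f(x₀, y₀) : Y → Z is a bounded invertible linear map with ‖(δ_y f(x₀, y₀))⁻¹‖ = θ; set φ := ‖δ_x f(x₀, y₀)‖ and σ := max{1 + θφ, θ}. Suppose there exists η > 0 such that (1) the open ball B_{2ησ}((x₀, y₀)) in X × Y is contained in U, and (2) ‖δf(x₁, y₁) − δf(x₂, y₂)‖ ≤ (1/(2ησ²))‖(x₁, y₁) − (x₂, y₂)‖ for all (x₁, y₁), (x₂, y₂) ∈ B_{2ησ}((x₀, y₀)). Then there is a unique continuously differentiable function g : B_η(x₀) → B_{2ησ}(y₀) such that g(x₀) = y₀ and f(x, g(x)) = 0 for all x ∈ B_η(x₀); moreover the derivative of g satisfies δg(x) = −(δ_y f(x, g(x)))⁻¹ ∘ (δ_x f(x, g(x))) for x ∈ B_η(x₀). -/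

import Mathlib

open Metric

/-- First-order Taylor estimate for a function whose derivative is Lipschitz around a point of a
convex set. -/
theorem Convex.norm_sub_sub_fderiv_le {E F : Type*} [NormedAddCommGroup E] [NormedSpace ℝ E]
    [NormedAddCommGroup F] [NormedSpace ℝ F] {s : Set E} (hs : Convex ℝ s)
    {f : E → F} {f' : E → E →L[ℝ] F} {L : ℝ} {a b : E} (ha : a ∈ s) (hb : b ∈ s)
    (hf : ∀ x ∈ s, HasFDerivAt f (f' x) x)
    (hL : ∀ x ∈ s, ‖f' x - f' a‖ ≤ L * ‖x - a‖) :
    ‖f b - f a - f' a (b - a)‖ ≤ L / 2 * ‖b - a‖ ^ 2 := by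
  have hmem : ∀ t ∈ Set.Icc (0 : ℝ) 1, a + t • (b - a) ∈ s := fun t ht =>
    hs.add_smul_sub_mem ha hb ht
  have hγ : ∀ t ∈ Set.Icc (0 : ℝ) 1,
      HasDerivAt (fun t : ℝ => f (a + t • (b - a)) - f a - t • f' a (b - a))
        ((f' (a + t • (b - a)) - f' a) (b - a)) t := by
    intro t ht
    have hline : HasDerivAt (fun t : ℝ => a + t • (b - a)) (b - a) t := by
      simpa using ((hasDerivAt_id t).smul_const (b - a)).const_add a
    have hlin : HasDerivAt (fun t : ℝ => t • f' a (b - a)) (f' a (b - a)) t := by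
      simpa using (hasDerivAt_id t).smul_const (f' a (b - a))
    exact (((hf _ (hmem t ht)).comp_hasDerivAt t hline).sub_const (f a)).sub hlin
  have hbound : ∀ t : ℝ,
      HasDerivAt (fun t : ℝ => L / 2 * ‖b - a‖ ^ 2 * t ^ 2) (L * ‖b - a‖ ^ 2 * t) t := by
    intro t
    convert! (hasDerivAt_pow 2 t).const_mul (L / 2 * ‖b - a‖ ^ 2) using 1
    norm_num
    ring
  have key := image_norm_le_of_norm_deriv_right_le_deriv_boundary
    (fun t ht => (hγ t ht).continuousAt.continuousWithinAt)
    (fun t ht => (hγ t (Set.Ico_subset_Icc_self ht)).hasDerivWithinAt)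
    (by simp) hbound (fun t ht => by
      have h := hL _ (hmem t (Set.Ico_subset_Icc_self ht))
      rw [add_sub_cancel_left, norm_smul, Real.norm_of_nonneg ht.1] at h
      calc _ ≤ ‖f' (a + t • (b - a)) - f' a‖ * ‖b - a‖ := ContinuousLinearMap.le_opNorm _ _
        _ ≤ L * (t * ‖b - a‖) * ‖b - a‖ := by gcongr
        _ = L * ‖b - a‖ ^ 2 * t := by ring)
    (Set.right_mem_Icc.2 zero_le_one)
  simpa using key

/-- Banach fixed point theorem on a closed ball. -/
theorem exists_fixedPoint_mem_closedBall {Y : Type*} [MetricSpace Y] [CompleteSpace Y]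
    {T : Y → Y} {y₀ : Y} {r k : ℝ} (hr : 0 ≤ r) (hk : k < 1)
    (hT : Set.MapsTo T (closedBall y₀ r) (closedBall y₀ r))
    (hlip : ∀ y ∈ closedBall y₀ r, ∀ y' ∈ closedBall y₀ r, dist (T y) (T y') ≤ k * dist y y') :
    ∃ y ∈ closedBall y₀ r, T y = y := by
  have hc : ContractingWith k.toNNReal (hT.restrict T _ _) := by
    refine ⟨by simpa using hk, LipschitzWith.of_dist_le_mul fun y y' => ?_⟩
    exact (hlip y y.2 y' y'.2).trans
      (mul_le_mul_of_nonneg_right (Real.le_coe_toNNReal k) dist_nonneg)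
  obtain ⟨y, hy, hfix, -⟩ := hc.exists_fixedPoint' isClosed_closedBall.isComplete hT
    (mem_closedBall_self hr) (edist_ne_top _ _)
  exact ⟨y, hy, hfix⟩

/-- A map that an approximate inverse carries close to the identity is invertible. -/
theorem ContinuousLinearEquiv.isInvertible_of_norm_id_sub_lt_one {Y Z : Type*}
    [NormedAddCommGroup Y] [NormedSpace ℝ Y] [CompleteSpace Y]
    [NormedAddCommGroup Z] [NormedSpace ℝ Z] (A : Y ≃L[ℝ] Z) {D : Y →L[ℝ] Z}
    (h : ‖ContinuousLinearMap.id ℝ Y - (A.symm : Z →L[ℝ] Y).comp D‖ < 1) :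
    D.IsInvertible := by
  obtain ⟨u, hu⟩ := isUnit_one_sub_of_norm_lt_one h
  refine ⟨(ContinuousLinearEquiv.unitsEquiv ℝ Y u).trans A, ?_⟩
  ext y
  have hy : (u : Y →L[ℝ] Y) y = A.symm (D y) := by
    rw [hu]
    simp
  simp [hy]

/-- Quantitative implicit function theorem: given `f : X × Y → Z` continuously
differentiable on an open set `U`, `f(x₀,y₀) = 0`, an invertible partial derivative
`δ_y f(x₀,y₀)` with inverse norm `θ`, `φ := ‖δ_x f(x₀,y₀)‖`, `σ := max (1 + θφ) θ`,
and quantitative ball-containment and Lipschitz conditions, there is a unique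
continuously differentiable implicit function `g : B_η(x₀) → B_{2ησ}(y₀)` with
`g x₀ = y₀`, `f(x, g x) = 0` and `δg(x) = −(δ_y f(x, g x))⁻¹ ∘ δ_x f(x, g x)`. -/
theorem quantitative_implicit_function_theorem
    {X Y Z : Type*} [NormedAddCommGroup X] [NormedSpace ℝ X] [CompleteSpace X]
    [NormedAddCommGroup Y] [NormedSpace ℝ Y] [CompleteSpace Y]
    [NormedAddCommGroup Z] [NormedSpace ℝ Z] [CompleteSpace Z]
    (U : Set (X × Y)) (hU : IsOpen U)
    (f : X × Y → Z) (f' : X × Y → (X × Y) →L[ℝ] Z)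
    (hderiv : ∀ p ∈ U, HasFDerivAt f (f' p) p)
    (hcont : ContinuousOn f' U)
    (x₀ : X) (y₀ : Y) (hmem : (x₀, y₀) ∈ U) (hf0 : f (x₀, y₀) = 0)
    -- `δ_y f(x₀,y₀)` is a bounded invertible linear map with inverse `B`, `‖B‖ = θ`
    (B : Z →L[ℝ] Y)
    (hB₁ : ∀ y : Y, B ((f' (x₀, y₀)).comp (ContinuousLinearMap.inr ℝ X Y) y) = y)
    (hB₂ : ∀ z : Z, (f' (x₀, y₀)).comp (ContinuousLinearMap.inr ℝ X Y) (B z) = z)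
    (θ φ σ : ℝ)
    (hθ : θ = ‖B‖)
    (hφ : φ = ‖(f' (x₀, y₀)).comp (ContinuousLinearMap.inl ℝ X Y)‖)
    (hσ : σ = max (1 + θ * φ) θ)
    (η : ℝ) (hη : 0 < η)
    -- (1) `B_{2ησ}((x₀,y₀)) ⊆ U`
    (hball : ball ((x₀, y₀) : X × Y) (2 * η * σ) ⊆ U)
    -- (2) quantitative Lipschitz condition on `δf` over `B_{2ησ}((x₀,y₀))`
    (hLip : ∀ p ∈ ball ((x₀, y₀) : X × Y) (2 * η * σ),
      ∀ q ∈ ball ((x₀, y₀) : X × Y) (2 * η * σ),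
        ‖f' p - f' q‖ ≤ (1 / (2 * η * σ ^ 2)) * ‖p - q‖) :
    ∃ g : X → Y,
      (ContDiffOn ℝ 1 g (ball x₀ η) ∧
        Set.MapsTo g (ball x₀ η) (ball y₀ (2 * η * σ)) ∧
        g x₀ = y₀ ∧
        (∀ x ∈ ball x₀ η, f (x, g x) = 0) ∧
        -- the derivative formula `δg(x) = −(δ_y f(x, g x))⁻¹ ∘ δ_x f(x, g x)`
        (∀ x ∈ ball x₀ η,
          ∃ Binv : Z →L[ℝ] Y,
            (∀ y : Y, Binv ((f' (x, g x)).comp (ContinuousLinearMap.inr ℝ X Y) y) = y) ∧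
            (∀ z : Z, (f' (x, g x)).comp (ContinuousLinearMap.inr ℝ X Y) (Binv z) = z) ∧
            HasFDerivAt g
              (-(Binv.comp ((f' (x, g x)).comp (ContinuousLinearMap.inl ℝ X Y)))) x)) ∧
      ∀ g₂ : X → Y,
        (ContDiffOn ℝ 1 g₂ (ball x₀ η) ∧
          Set.MapsTo g₂ (ball x₀ η) (ball y₀ (2 * η * σ)) ∧
          g₂ x₀ = y₀ ∧
          ∀ x ∈ ball x₀ η, f (x, g₂ x) = 0) →
        ∀ x ∈ ball x₀ η, g₂ x = g x := by
  have hθ0 : 0 ≤ θ := hθ ▸ norm_nonneg _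
  have hφ0 : 0 ≤ φ := hφ ▸ norm_nonneg _
  have hσ1 : 1 + θ * φ ≤ σ := hσ ▸ le_max_left _ _
  have hθσ : θ ≤ σ := hσ ▸ le_max_right _ _
  have hθφ : 0 ≤ θ * φ := mul_nonneg hθ0 hφ0
  have hσ0 : 1 ≤ σ := by linarith
  have hσpos : 0 < σ := by linarith
  have hησ : η ≤ η * σ := le_mul_of_one_le_right hη.le hσ0
  let A : Y ≃L[ℝ] Z := ContinuousLinearEquiv.equivOfInverse
    ((f' (x₀, y₀)).comp (ContinuousLinearMap.inr ℝ X Y)) B hB₁ hB₂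
  have hinj : ∀ z, B z = 0 → z = 0 := fun z hz => by rw [← hB₂ z, hz, map_zero]
  have hp₀ : ((x₀, y₀) : X × Y) ∈ ball ((x₀, y₀) : X × Y) (2 * η * σ) :=
    mem_ball_self (by positivity)
  -- the partial derivative, composed with `B`, stays close to the identity
  have hnear : ∀ p ∈ ball ((x₀, y₀) : X × Y) (2 * η * σ),
      ‖ContinuousLinearMap.id ℝ Y - B.comp ((f' p).comp (ContinuousLinearMap.inr ℝ X Y))‖
        ≤ ‖p - (x₀, y₀)‖ / (2 * η * σ) := by
    intro p hp
    have heq : ContinuousLinearMap.id ℝ Y - B.comp ((f' p).comp (ContinuousLinearMap.inr ℝ X Y))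
        = B.comp ((f' (x₀, y₀) - f' p).comp (ContinuousLinearMap.inr ℝ X Y)) := by
      ext y
      rw [ContinuousLinearMap.sub_comp, ContinuousLinearMap.comp_sub,
        sub_apply, sub_apply,
        ContinuousLinearMap.comp_apply B, ContinuousLinearMap.comp_apply B, hB₁,
        ContinuousLinearMap.id_apply]
    rw [heq]
    calc _ ≤ ‖B‖ * (‖f' (x₀, y₀) - f' p‖ * ‖ContinuousLinearMap.inr ℝ X Y‖) :=
          (ContinuousLinearMap.opNorm_comp_le _ _).trans
            (by gcongr; exact ContinuousLinearMap.opNorm_comp_le _ _)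
      _ ≤ σ * ((1 / (2 * η * σ ^ 2)) * ‖p - (x₀, y₀)‖ * 1) := by
          have := hLip _ hp _ hp₀
          rw [norm_sub_rev] at this
          gcongr
          · exact hθ ▸ hθσ
          · exact ContinuousLinearMap.norm_inr_le_one ℝ X Y
      _ = ‖p - (x₀, y₀)‖ / (2 * η * σ) := by field_simp
  have hprod : ∀ r, η ≤ r → ∀ x ∈ ball x₀ η, ∀ y ∈ closedBall y₀ r,
      ‖((x, y) : X × Y) - (x₀, y₀)‖ ≤ r := by
    intro r hr x hx y hy
    rw [← dist_eq_norm, Prod.dist_eq]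
    exact max_le ((mem_ball.1 hx).le.trans hr) hy
  have hprod_mem : ∀ r, η ≤ r → r < 2 * η * σ → ∀ x ∈ ball x₀ η, ∀ y ∈ closedBall y₀ r,
      ((x, y) : X × Y) ∈ ball ((x₀, y₀) : X × Y) (2 * η * σ) := by
    intro r hr hr' x hx y hy
    rw [mem_ball, dist_eq_norm]
    exact (hprod r hr x hx y hy).trans_lt hr'
  have hcontr : ∀ r, η ≤ r → r < 2 * η * σ → ∀ x ∈ ball x₀ η,
      ∀ y ∈ closedBall y₀ r, ∀ y' ∈ closedBall y₀ r,
        dist (y - B (f (x, y))) (y' - B (f (x, y'))) ≤ r / (2 * η * σ) * dist y y' := by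
    intro r hr hr' x hx y hy y' hy'
    rw [dist_eq_norm, dist_eq_norm]
    refine (convex_closedBall y₀ r).norm_image_sub_le_of_norm_hasFDerivWithin_le
      (f := fun y => y - B (f (x, y)))
      (f' := fun y => ContinuousLinearMap.id ℝ Y -
        B.comp ((f' (x, y)).comp (ContinuousLinearMap.inr ℝ X Y)))
      (fun w hw => ?_) (fun w hw => ?_) hy' hy
    · have hf := hderiv _ (hball (hprod_mem r hr hr' x hx w hw))
      exact ((hasFDerivAt_id w).sub
        (B.hasFDerivAt.comp w (hf.comp w (hasFDerivAt_prodMk_right x w)))).hasFDerivWithinAt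
    · refine (hnear _ (hprod_mem r hr hr' x hx w hw)).trans ?_
      gcongr
      exact hprod r hr x hx w hw
  have huniq : ∀ x ∈ ball x₀ η, ∀ y ∈ ball y₀ (2 * η * σ), ∀ y' ∈ ball y₀ (2 * η * σ),
      f (x, y) = 0 → f (x, y') = 0 → y = y' := by
    intro x hx y hy y' hy' h h'
    have hlt : max η (max (dist y y₀) (dist y' y₀)) < 2 * η * σ :=
      max_lt (by linarith) (max_lt hy hy')
    have hd := hcontr _ (le_max_left _ _) hlt x hx y
      (mem_closedBall.2 ((le_max_left _ _).trans (le_max_right _ _))) y'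
      (mem_closedBall.2 ((le_max_right _ _).trans (le_max_right _ _)))
    rw [h, h', map_zero, sub_zero, sub_zero] at hd
    have hk : max η (max (dist y y₀) (dist y' y₀)) / (2 * η * σ) < 1 :=
      (div_lt_one (by positivity)).2 hlt
    refine dist_le_zero.1 ?_
    by_contra! hpos
    nlinarith
  -- the fixed-point iteration preserves the closed ball of radius `η (2σ - 1)`
  have hR : η ≤ η * (2 * σ - 1) := le_mul_of_one_le_right hη.le (by linarith)
  have hR' : η * (2 * σ - 1) < 2 * η * σ := by linarith
  have hexists : ∀ x ∈ ball x₀ η, ∃ y ∈ ball y₀ (2 * η * σ), f (x, y) = 0 := by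
    intro x hx
    have hmaps : Set.MapsTo (fun y => y - B (f (x, y))) (closedBall y₀ (η * (2 * σ - 1)))
        (closedBall y₀ (η * (2 * σ - 1))) := by
      intro y hy
      have htaylor := (convex_ball ((x₀, y₀) : X × Y) (2 * η * σ)).norm_sub_sub_fderiv_le hp₀
        (hprod_mem _ hR hR' x hx y hy) (fun p hp => hderiv p (hball hp))
        (fun p hp => hLip p hp _ hp₀)
      have hnorm := hprod _ hR x hx y hy
      have hsplit : f' (x₀, y₀) ((x, y) - (x₀, y₀)) =
          (f' (x₀, y₀)).comp (ContinuousLinearMap.inl ℝ X Y) (x - x₀) +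
          (f' (x₀, y₀)).comp (ContinuousLinearMap.inr ℝ X Y) (y - y₀) := by
        simp [← map_add]
      have heq : y - B (f (x, y)) - y₀ =
          -(B ((f' (x₀, y₀)).comp (ContinuousLinearMap.inl ℝ X Y) (x - x₀)) +
            B (f (x, y) - f (x₀, y₀) - f' (x₀, y₀) ((x, y) - (x₀, y₀)))) := by
        rw [hsplit, hf0, sub_zero, B.map_sub (f (x, y)), B.map_add, hB₁]
        abel
      rw [mem_closedBall, dist_eq_norm, heq, norm_neg]
      have hx' : ‖x - x₀‖ ≤ η := by simpa [dist_eq_norm] using (mem_ball.1 hx).le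
      have hfirst : ‖B ((f' (x₀, y₀)).comp (ContinuousLinearMap.inl ℝ X Y) (x - x₀))‖
          ≤ θ * (φ * η) := by
        rw [hθ, hφ]
        refine (B.le_opNorm _).trans ?_
        gcongr
        refine (ContinuousLinearMap.le_opNorm _ _).trans ?_
        gcongr
      have hsecond : ‖B (f (x, y) - f (x₀, y₀) - f' (x₀, y₀) ((x, y) - (x₀, y₀)))‖
          ≤ σ * ((1 / (2 * η * σ ^ 2)) / 2 * (η * (2 * σ - 1)) ^ 2) := by
        refine (B.le_opNorm _).trans ?_
        rw [← hθ]
        gcongr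
        refine htaylor.trans ?_
        gcongr
      have hval : σ * ((1 / (2 * η * σ ^ 2)) / 2 * (η * (2 * σ - 1)) ^ 2) ≤ η * σ := by
        have : σ * ((1 / (2 * η * σ ^ 2)) / 2 * (η * (2 * σ - 1)) ^ 2)
            = η * (2 * σ - 1) ^ 2 / (4 * σ) := by
          field_simp
          ring
        rw [this, div_le_iff₀ (by positivity)]
        have : (2 * σ - 1) ^ 2 ≤ 4 * σ * σ := by nlinarith
        nlinarith
      have : η * (1 + θ * φ) ≤ η * σ := by gcongr
      refine (norm_add_le _ _).trans ((add_le_add hfirst (hsecond.trans hval)).trans ?_)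
      nlinarith
    obtain ⟨y, hy, hfix⟩ := exists_fixedPoint_mem_closedBall (hη.le.trans hR)
      ((div_lt_one (by positivity)).2 hR') hmaps (hcontr _ hR hR' x hx)
    exact ⟨y, closedBall_subset_ball hR' hy, hinj _ (by simpa using hfix)⟩
  choose! g hgmem hgf using hexists
  have hgmem' : ∀ x ∈ ball x₀ η, (x, g x) ∈ ball ((x₀, y₀) : X × Y) (2 * η * σ) := fun x hx =>
    hprod_mem _ (le_max_left η (dist (g x) y₀)) (max_lt (by linarith) (hgmem x hx)) x hx _
      (mem_closedBall.2 (le_max_right _ _))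
  have hinv : ∀ x ∈ ball x₀ η,
      ((f' (x, g x)).comp (ContinuousLinearMap.inr ℝ X Y)).IsInvertible := fun x hx =>
    A.isInvertible_of_norm_id_sub_lt_one <| (hnear _ (hgmem' x hx)).trans_lt <|
      (div_lt_one (by positivity)).2 (by simpa [dist_eq_norm] using hgmem' x hx)
  have hfC : ContDiffOn ℝ 1 f U := (contDiffOn_succ_iff_fderiv_of_isOpen (n := 0) hU).2
    ⟨fun p hp => (hderiv p hp).differentiableAt.differentiableWithinAt, by simp,
      contDiffOn_zero.2 <| hcont.congr fun p hp => (hderiv p hp).fderiv⟩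
  have hlocal : ∀ x ∈ ball x₀ η, ContDiffAt ℝ 1 g x ∧
      HasFDerivAt g (-(((f' (x, g x)).comp (ContinuousLinearMap.inr ℝ X Y)).inverse.comp
        ((f' (x, g x)).comp (ContinuousLinearMap.inl ℝ X Y)))) x := by
    intro x hx
    have hmemU := hball (hgmem' x hx)
    have hcd : ContDiffAt ℝ 1 f (x, g x) := hfC.contDiffAt (hU.mem_nhds hmemU)
    have hfd : fderiv ℝ f (x, g x) = f' (x, g x) := (hderiv _ hmemU).fderiv
    have hI : (fderiv ℝ f (x, g x) ∘L .inr ℝ X Y).IsInvertible := hfd ▸ hinv x hx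
    have hCD := hcd.contDiffAt_implicitFunction one_ne_zero hI
    have hSD := (hcd.hasStrictFDerivAt_implicitFunction one_ne_zero hI).hasFDerivAt
    have heq : g =ᶠ[nhds x] hcd.implicitFunction one_ne_zero hI := by
      have htend : ∀ᶠ x' in nhds x,
          hcd.implicitFunction one_ne_zero hI x' ∈ ball y₀ (2 * η * σ) :=
        hCD.continuousAt.eventually_mem <| isOpen_ball.mem_nhds <| by
          have := hcd.implicitFunction_apply_self one_ne_zero hI
          simp only at this
          rw [this]
          exact hgmem x hx
      filter_upwards [htend, isOpen_ball.mem_nhds hx,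
        hcd.eventually_apply_implicitFunction one_ne_zero hI] with x' h₁ h₂ h₃
      exact huniq x' h₂ _ (hgmem x' h₂) _ h₁ (hgf x' h₂) (h₃.trans (hgf x hx))
    refine ⟨hCD.congr_of_eventuallyEq heq, ?_⟩
    have := hSD.congr_of_eventuallyEq heq
    rw [hfd] at this
    simpa using this
  refine ⟨g, ⟨fun x hx => (hlocal x hx).1.contDiffWithinAt, hgmem, ?_, hgf, fun x hx => ?_⟩, ?_⟩
  · have hx₀ : x₀ ∈ ball x₀ η := mem_ball_self hη
    exact huniq x₀ hx₀ _ (hgmem _ hx₀) _ (mem_ball_self (by positivity)) (hgf _ hx₀) hf0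
  · refine ⟨_, fun y => ?_, fun z => ?_, (hlocal x hx).2⟩
    · exact (hinv x hx).inverse_apply_eq.2 rfl
    · exact ((hinv x hx).inverse_apply_eq.1 rfl).symm
  · rintro g₂ ⟨-, hmaps, -, hg₂⟩ x hx
    exact huniq x hx _ (hmaps hx) _ (hgmem x hx) (hg₂ x hx) (hgf x hx)
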